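/- De Bruijn identity for Gaussian states and conditional entropy (Theorem 5.4, explicit Gaussian form): Let m, n ≥ 1 and let M_AB be a real symmetric positive-definite matrix of size 2(m+n), let S be a symplectic matrix and λ₁,…,λ_{m+n} reals with S·M_AB·Sᵀ = D_{m+n}(λ), and assume λ_ℓ > 1 for all ℓ. For t ≥ 0 let f(t) := E(M_AB + t·(I_A⊕0_B)) − E(M_B), the conditional entropy functional of the partially diffused matrix. Then f is differentiable at t = 0 with derivative f'(0) = (1/4)·Σ_{j=1}^{m+n} β(λ_j)·Σ_{k=1}^{2m} (S_{2j−1,k}² + S_{2j,k}²). -/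

import Mathlib

open scoped Classical ComplexOrder

noncomputable section

/-- The function `g(x) = (x+1)·log(x+1) − x·log x` (with `g 0 = 0` since `log 0 = 0`). -/
def gFn (x : ℝ) : ℝ := (x + 1) * Real.log (x + 1) - x * Real.log x

/-- Single-mode entropy as a function of the symplectic eigenvalue: `G(λ) = g((λ−1)/2)`. -/
def GFn (lam : ℝ) : ℝ := gFn ((lam - 1) / 2)

/-- Inverse temperature `β(λ) = log((λ+1)/(λ−1))`. -/
def betaFn (lam : ℝ) : ℝ := Real.log ((lam + 1) / (lam - 1))

/-- The standard symplectic form matrix on `ℝ^d` (for even `d = 2N` this is the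
block-diagonal matrix with `N` diagonal blocks `[[0,1],[-1,0]]`). -/
def Jmat (d : ℕ) : Matrix (Fin d) (Fin d) ℝ := fun i j =>
  if (i : ℕ) % 2 = 0 ∧ (j : ℕ) = (i : ℕ) + 1 then 1
  else if (j : ℕ) % 2 = 0 ∧ (i : ℕ) = (j : ℕ) + 1 then -1 else 0

/-- A real `d×d` matrix is symplectic if `S·J·Sᵀ = J`. -/
def IsSymplectic {d : ℕ} (S : Matrix (Fin d) (Fin d) ℝ) : Prop :=
  S * Jmat d * S.transpose = Jmat d

/-- The doubled diagonal matrix `D(λ) = diag(λ₀,λ₀,λ₁,λ₁,…)`. -/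
def Dmat (d : ℕ) (lam : ℕ → ℝ) : Matrix (Fin d) (Fin d) ℝ :=
  Matrix.diagonal fun i => lam ((i : ℕ) / 2)

/-- A valid quantum covariance matrix: `M` symmetric with `M + i·J ⪰ 0`. -/
def IsQCov {d : ℕ} (M : Matrix (Fin d) (Fin d) ℝ) : Prop :=
  M.IsSymm ∧
    (M.map (Complex.ofReal) + Complex.I • (Jmat d).map Complex.ofReal).PosSemidef

/-- Entropy functional `E(M) = Σⱼ G(λⱼ)` where `λⱼ` are the symplectic eigenvalues of `M`:
the eigenvalues of `i·J·M` are `±λⱼ`, so `E(M) = (1/2)·Σ_{μ root of charpoly} G(|Re μ|)`. -/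
def Ent {d : ℕ} (M : Matrix (Fin d) (Fin d) ℝ) : ℝ :=
  ((Matrix.charpoly (Complex.I • ((Jmat d * M).map Complex.ofReal))).roots.map
    fun μ => GFn |μ.re|).sum / 2

/-- The matrix `I_A ⊕ 0_B`: identity on the first `a` coordinates, zero on the rest. -/
def IA0B (d a : ℕ) : Matrix (Fin d) (Fin d) ℝ :=
  Matrix.diagonal fun i => if (i : ℕ) < a then 1 else 0

/-- Assemble a symmetric 2×2 block matrix `[[A, K], [Kᵀ, B]]`. -/
def assemble2 {a b : ℕ} (A : Matrix (Fin a) (Fin a) ℝ) (K : Matrix (Fin a) (Fin b) ℝ)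
    (B : Matrix (Fin b) (Fin b) ℝ) : Matrix (Fin (a + b)) (Fin (a + b)) ℝ := fun i j =>
  if hi : (i : ℕ) < a then
    if hj : (j : ℕ) < a then A ⟨i, hi⟩ ⟨j, hj⟩
    else K ⟨i, hi⟩ ⟨(j : ℕ) - a, by have := j.isLt; omega⟩
  else
    if hj : (j : ℕ) < a then K ⟨j, hj⟩ ⟨(i : ℕ) - a, by have := i.isLt; omega⟩
    else B ⟨(i : ℕ) - a, by have := i.isLt; omega⟩ ⟨(j : ℕ) - a, by have := j.isLt; omega⟩

/-- Assemble the symmetric 3×3 block matrix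
`[[Y, K₁, K₂], [K₁ᵀ, B₁, 0], [K₂ᵀ, 0, B₂]]`. -/
def assemble3 {a b c : ℕ} (Y : Matrix (Fin a) (Fin a) ℝ)
    (K₁ : Matrix (Fin a) (Fin b) ℝ) (K₂ : Matrix (Fin a) (Fin c) ℝ)
    (B₁ : Matrix (Fin b) (Fin b) ℝ) (B₂ : Matrix (Fin c) (Fin c) ℝ) :
    Matrix (Fin (a + b + c)) (Fin (a + b + c)) ℝ := fun i j =>
  if hi : (i : ℕ) < a then
    if hj : (j : ℕ) < a then Y ⟨i, hi⟩ ⟨j, hj⟩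
    else if hj' : (j : ℕ) < a + b then K₁ ⟨i, hi⟩ ⟨(j : ℕ) - a, by omega⟩
    else K₂ ⟨i, hi⟩ ⟨(j : ℕ) - a - b, by have := j.isLt; omega⟩
  else if hi' : (i : ℕ) < a + b then
    if hj : (j : ℕ) < a then K₁ ⟨j, hj⟩ ⟨(i : ℕ) - a, by omega⟩
    else if hj' : (j : ℕ) < a + b then
      B₁ ⟨(i : ℕ) - a, by omega⟩ ⟨(j : ℕ) - a, by omega⟩
    else 0
  else
    if hj : (j : ℕ) < a then K₂ ⟨j, hj⟩ ⟨(i : ℕ) - a - b, by have := i.isLt; omega⟩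
    else if hj' : (j : ℕ) < a + b then 0
    else B₂ ⟨(i : ℕ) - a - b, by have := i.isLt; omega⟩
      ⟨(j : ℕ) - a - b, by have := j.isLt; omega⟩


theorem Jmat_mul_self (N d : ℕ) (hd : d = 2 * N) : Jmat d * Jmat d = -1 := by
  subst hd
  ext i j
  have hi := i.isLt
  have hj := j.isLt
  rw [Matrix.mul_apply, Matrix.neg_apply, Matrix.one_apply]
  obtain h | h := Nat.mod_two_eq_zero_or_one (i : ℕ)
  · rw [Finset.sum_eq_single (⟨(i : ℕ) + 1, by omega⟩ : Fin (2 * N))]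
    · simp only [Jmat, Fin.ext_iff, and_true]
      split_ifs <;> first | (exfalso; omega) | norm_num
    · intro b _ hb
      have : Jmat (2 * N) i b = 0 := by
        simp only [Jmat, ne_eq, Fin.ext_iff] at hb ⊢
        split_ifs <;> first | omega | rfl
      rw [this, zero_mul]
    · simp
  · rw [Finset.sum_eq_single (⟨(i : ℕ) - 1, by omega⟩ : Fin (2 * N))]
    · simp only [Jmat, Fin.ext_iff]
      split_ifs <;> first | (exfalso; omega) | norm_num
    · intro b _ hb
      have : Jmat (2 * N) i b = 0 := by
        simp only [Jmat, ne_eq, Fin.ext_iff] at hb ⊢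
        split_ifs <;> first | omega | rfl
      rw [this, zero_mul]
    · simp

theorem Jmat_transpose (d : ℕ) : (Jmat d).transpose = -Jmat d := by
  ext i j
  simp only [Matrix.transpose_apply, Matrix.neg_apply, Jmat]
  split_ifs <;> first | omega | simp

theorem Jmat_mul_Dmat (d : ℕ) (lam : ℕ → ℝ) : Jmat d * Dmat d lam = Dmat d lam * Jmat d := by
  ext i j
  rw [Dmat, Matrix.mul_diagonal, Matrix.diagonal_mul, mul_comm]
  by_cases h : (i : ℕ) / 2 = (j : ℕ) / 2
  · rw [h]
  · have : Jmat d i j = 0 := by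
      simp only [Jmat]
      split_ifs <;> first | omega | rfl
    simp [this]

/-- The transpose of a symplectic matrix is symplectic. -/
theorem IsSymplectic.transpose_mul {d : ℕ} (hJ : Jmat d * Jmat d = -1)
    {S : Matrix (Fin d) (Fin d) ℝ} (hS : IsSymplectic S) : S.transpose * Jmat d * S = Jmat d := by
  have h1 : S * (Jmat d * S.transpose * -Jmat d) = 1 := by
    calc S * (Jmat d * S.transpose * -Jmat d) = -(S * Jmat d * S.transpose * Jmat d) := by
          noncomm_ring
      _ = 1 := by rw [hS, hJ, neg_neg]
  have h2 := mul_eq_one_comm.mp h1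
  calc S.transpose * Jmat d * S
      = -(Jmat d * Jmat d) * S.transpose * Jmat d * S := by rw [hJ]; simp
    _ = Jmat d * ((Jmat d * S.transpose * -Jmat d) * S) := by noncomm_ring
    _ = Jmat d := by rw [h2, mul_one]

/-- The entropy is invariant under symplectic congruence. -/
theorem Ent_symplectic {d : ℕ} (hJ : Jmat d * Jmat d = -1)
    {S : Matrix (Fin d) (Fin d) ℝ} (hS : IsSymplectic S) (M : Matrix (Fin d) (Fin d) ℝ) :
    Ent (S * M * S.transpose) = Ent M := by
  have hmap : ∀ A B : Matrix (Fin d) (Fin d) ℝ, Complex.I • (A * B).map Complex.ofReal =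
      (Complex.I • A.map Complex.ofReal) * B.map Complex.ofReal := by
    intro A B
    rw [Matrix.smul_mul]
    congr 1
    exact Matrix.map_mul (f := Complex.ofRealHom)
  have hmap' : ∀ A B : Matrix (Fin d) (Fin d) ℝ, Complex.I • (A * B).map Complex.ofReal =
      A.map Complex.ofReal * (Complex.I • B.map Complex.ofReal) := by
    intro A B
    rw [Matrix.mul_smul]
    congr 1
    exact Matrix.map_mul (f := Complex.ofRealHom)
  unfold Ent
  congr 4
  rw [← Matrix.mul_assoc, hmap, Matrix.charpoly_mul_comm, ← hmap']
  rw [← Matrix.mul_assoc, ← Matrix.mul_assoc, hS.transpose_mul hJ]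

/-- Hermite interpolation: values and derivatives can be prescribed on a finite set. -/
theorem exists_polynomial_eval_derivative_eval (s : Finset ℝ) (f f' : ℝ → ℝ) :
    ∃ q : Polynomial ℝ, ∀ x ∈ s, q.eval x = f x ∧ q.derivative.eval x = f' x := by
  have hinj : Set.InjOn (id : ℝ → ℝ) (s : Set ℝ) := Set.injOn_id _
  set p := Lagrange.interpolate s id f with hp
  set w := Lagrange.nodal s (id : ℝ → ℝ) with hw
  refine ⟨p + w * Lagrange.interpolate s id
    (fun x => (f' x - p.derivative.eval x) / w.derivative.eval x), fun x hx => ?_⟩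
  have hw0 : w.eval x = 0 := Lagrange.eval_nodal_at_node (v := id) hx
  have hw1 : w.derivative.eval x ≠ 0 := by
    have := Lagrange.eval_nodal_derivative_eval_node_eq (v := (id : ℝ → ℝ)) hx
    rw [id] at this
    rw [this]
    exact Lagrange.eval_nodal_not_at_node fun i hi => (Finset.ne_of_mem_erase hi).symm
  have e1 : ∀ r : ℝ → ℝ, (Lagrange.interpolate s id r).eval x = r x := fun r =>
    Lagrange.eval_interpolate_at_node (v := id) r hinj hx
  constructor
  · rw [Polynomial.eval_add, Polynomial.eval_mul, hw0, zero_mul, add_zero, hp, e1]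
  · simp only [Polynomial.derivative_add, Polynomial.derivative_mul, Polynomial.eval_add,
      Polynomial.eval_mul, hw0, e1]
    field_simp
    ring

theorem hasDerivAt_GFn {x : ℝ} (hx : 1 < x) : HasDerivAt GFn (betaFn x / 2) x := by
  have h1 : HasDerivAt (fun y : ℝ => (y - 1) / 2) (1 / 2) x :=
    ((hasDerivAt_id x).sub_const 1).div_const 2
  have h2 : HasDerivAt (fun y : ℝ => (y - 1) / 2 + 1) (1 / 2) x := h1.add_const 1
  have h3 := (Real.hasDerivAt_mul_log (x := (x - 1) / 2) (by linarith)).comp x h1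
  have h4 := (Real.hasDerivAt_mul_log (x := (x - 1) / 2 + 1) (by linarith)).comp x h2
  refine (h4.sub h3).congr_deriv ?_
  have e : (x - 1) / 2 + 1 = (x + 1) / 2 := by ring
  rw [betaFn, Real.log_div (by linarith) (sub_pos.mpr hx).ne', e, Real.log_div (by linarith) (by norm_num),
    Real.log_div (sub_pos.mpr hx).ne' (by norm_num)]
  ring

theorem hasDerivAt_GFn_sqrt {x : ℝ} (hx : 1 < x) :
    HasDerivAt (fun s => GFn (√s)) (betaFn x / (4 * x)) (x ^ 2) := by
  have e : √(x ^ 2) = x := Real.sqrt_sq (by linarith)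
  have h1 : HasDerivAt (fun s : ℝ => √s) (1 / (2 * √(x ^ 2))) (x ^ 2) :=
    Real.hasDerivAt_sqrt (by positivity)
  have h2 : HasDerivAt GFn (betaFn x / 2) (√(x ^ 2)) := by rw [e]; exact hasDerivAt_GFn hx
  refine (h2.comp _ h1).congr_deriv ?_
  rw [e]
  field_simp
  norm_num
/-- Entrywise differentiability of a polynomial in a matrix curve starting at a diagonal matrix,
with the diagonal entries of the derivative. -/
theorem exists_hasDerivAt_aeval {d : ℕ} (N : ℝ → Matrix (Fin d) (Fin d) ℝ)
    (X : Matrix (Fin d) (Fin d) ℝ) (e : Fin d → ℝ)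
    (hN : ∀ i j, HasDerivAt (fun t => N t i j) (X i j) 0) (h0 : N 0 = Matrix.diagonal e)
    (q : Polynomial ℝ) :
    ∃ Y : Matrix (Fin d) (Fin d) ℝ,
      (∀ i j, HasDerivAt (fun t => Polynomial.aeval (N t) q i j) (Y i j) 0) ∧
      ∀ i, Y i i = q.derivative.eval (e i) * X i i := by
  have hpow : ∀ k : ℕ, ∃ Y : Matrix (Fin d) (Fin d) ℝ,
      (∀ i j, HasDerivAt (fun t => (N t ^ k) i j) (Y i j) 0) ∧
      ∀ i, Y i i = k * e i ^ (k - 1) * X i i := by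
    intro k
    induction k with
    | zero =>
      exact ⟨0, fun i j => by simpa using hasDerivAt_const (0 : ℝ) _, fun i => by simp⟩
    | succ k ih =>
      obtain ⟨Y, hY, hYd⟩ := ih
      refine ⟨Y * N 0 + N 0 ^ k * X, fun i j => ?_, fun i => ?_⟩
      · simp only [pow_succ, Matrix.mul_apply, Matrix.add_apply]
        rw [← Finset.sum_add_distrib]
        exact HasDerivAt.fun_sum fun l _ => (hY i l).mul (hN l j)
      · rw [h0, Matrix.diagonal_pow, Matrix.add_apply, Matrix.mul_diagonal, Matrix.diagonal_mul,
          hYd]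
        rcases k with _ | k
        · simp
        · simp only [Pi.pow_apply, Nat.add_sub_cancel]
          push_cast
          ring
  induction q using Polynomial.induction_on' with
  | add p q hp hq =>
    obtain ⟨Y, hY, hYd⟩ := hp
    obtain ⟨Z, hZ, hZd⟩ := hq
    refine ⟨Y + Z, fun i j => ?_, fun i => ?_⟩
    · simp only [map_add, Matrix.add_apply]
      exact (hY i j).add (hZ i j)
    · simp only [Matrix.add_apply, hYd, hZd, Polynomial.derivative_add, Polynomial.eval_add]
      ring
  | monomial k a =>
    obtain ⟨Y, hY, hYd⟩ := hpow k
    refine ⟨a • Y, fun i j => ?_, fun i => ?_⟩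
    · simpa only [Polynomial.aeval_monomial, ← Algebra.smul_def, Matrix.smul_apply, smul_eq_mul]
        using (hY i j).const_mul a
    · simp only [Matrix.smul_apply, hYd, smul_eq_mul, Polynomial.derivative_monomial,
        Polynomial.eval_monomial]
      ring

theorem trace_aeval_mul_comm {R : Type*} [CommRing R] {d : ℕ} (A B : Matrix (Fin d) (Fin d) R)
    (q : Polynomial R) :
    (Polynomial.aeval (A * B) q).trace = (Polynomial.aeval (B * A) q).trace := by
  induction q using Polynomial.induction_on' with
  | add p q hp hq => simp only [map_add, Matrix.trace_add, hp, hq]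
  | monomial k a =>
    simp only [Polynomial.aeval_monomial, ← Algebra.smul_def, Matrix.trace_smul]
    congr 1
    rcases k with _ | k
    · simp
    · rw [pow_succ, ← mul_assoc, mul_pow_mul, mul_assoc, Matrix.trace_mul_comm, pow_succ, mul_assoc]

theorem trace_aeval_of_isHermitian {d : ℕ} {H : Matrix (Fin d) (Fin d) ℂ} (hH : H.IsHermitian)
    (q : Polynomial ℂ) :
    (Polynomial.aeval H q).trace = ∑ i, q.eval (hH.eigenvalues i : ℂ) := by
  conv_lhs => rw [hH.spectral_theorem]
  have h : ∀ v : Fin d → ℂ, Polynomial.aeval (Matrix.diagonal v) q =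
      Matrix.diagonal (Polynomial.aeval v q) := fun v =>
    Polynomial.aeval_algHom_apply (Matrix.diagonalAlgHom ℂ) v q
  set φ := Unitary.conjStarAlgAut ℂ (Matrix (Fin d) (Fin d) ℂ) hH.eigenvectorUnitary with hφ
  have h' : ∀ D, Polynomial.aeval (φ D) q = φ (Polynomial.aeval D q) := fun D =>
    Polynomial.aeval_algHom_apply φ D q
  rw [h', h, hφ, Unitary.conjStarAlgAut_apply, Matrix.trace_mul_comm, ← mul_assoc,
    Unitary.coe_star_mul_self, one_mul, Matrix.trace_diagonal]
  refine Finset.sum_congr rfl fun i _ => ?_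
  rw [Polynomial.aeval_pi_apply]
  simp

theorem exists_eq_conjTranspose_mul_self {d : ℕ} {M : Matrix (Fin d) (Fin d) ℝ}
    (hM : M.PosSemidef) : ∃ B : Matrix (Fin d) (Fin d) ℝ, M = B.transpose * B := by
  have hd : Matrix.diagonal (RCLike.ofReal ∘ hM.1.eigenvalues) =
      Matrix.diagonal (fun i => √(hM.1.eigenvalues i)) *
        Matrix.diagonal (fun i => √(hM.1.eigenvalues i)) := by
    rw [Matrix.diagonal_mul_diagonal]
    congr 1
    ext i
    simp [Real.mul_self_sqrt (hM.eigenvalues_nonneg i)]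
  refine ⟨Matrix.diagonal (fun i => √(hM.1.eigenvalues i)) *
    star (hM.1.eigenvectorUnitary : Matrix (Fin d) (Fin d) ℝ), ?_⟩
  conv_lhs => rw [hM.1.spectral_theorem, Unitary.conjStarAlgAut_apply, hd]
  rw [Matrix.transpose_mul, Matrix.diagonal_transpose, Matrix.star_eq_conjTranspose,
    Matrix.conjTranspose_eq_transpose_of_trivial, Matrix.transpose_transpose]
  simp only [Matrix.mul_assoc]

/-- For positive semidefinite `M`, the matrix `i·J·M` has real eigenvalues `ev`, which compute the
entropy and whose squares are the eigenvalues of `-(J·M)²`. -/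
theorem exists_eigenvalues_Ent {d : ℕ} {M : Matrix (Fin d) (Fin d) ℝ} (hM : M.PosSemidef) :
    ∃ ev : Fin d → ℝ, Ent M = (∑ i, GFn |ev i|) / 2 ∧
      (∀ q : Polynomial ℝ, ∑ i, q.eval (ev i ^ 2) =
        (Polynomial.aeval (-(Jmat d * M * (Jmat d * M))) q).trace) ∧
      ∀ i, ∃ k, |ev i ^ 2 - (-(Jmat d * M * (Jmat d * M))) k k| ≤
        ∑ j ∈ Finset.univ.erase k, |(-(Jmat d * M * (Jmat d * M))) k j| := by
  obtain ⟨B, hB⟩ := exists_eq_conjTranspose_mul_self hM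
  set c : Matrix (Fin d) (Fin d) ℝ →ₐ[ℝ] Matrix (Fin d) (Fin d) ℂ :=
    Complex.ofRealAm.mapMatrix with hc
  have hcmap : ∀ A : Matrix (Fin d) (Fin d) ℝ, A.map Complex.ofReal = c A := fun A => rfl
  set L : Matrix (Fin d) (Fin d) ℂ := Complex.I • c (Jmat d) * c B.transpose with hL
  set A : Matrix (Fin d) (Fin d) ℂ := Complex.I • c (Jmat d * M) with hA
  have hAL : A = L * c B := by
    rw [hA, hB, hL, Matrix.smul_mul, Matrix.smul_mul, map_mul, map_mul, mul_assoc]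
  have hH : (c B * L).IsHermitian := by
    have h1 : ∀ X : Matrix (Fin d) (Fin d) ℝ, (c X).conjTranspose = c X.transpose := by
      intro X
      ext i j
      simp [← hcmap]
    rw [Matrix.IsHermitian, hL, Matrix.conjTranspose_mul, Matrix.conjTranspose_mul,
      Matrix.conjTranspose_smul, h1, h1, h1, Jmat_transpose, Matrix.transpose_transpose]
    simp [Matrix.mul_assoc]
  have hroots : A.charpoly.roots =
      Multiset.map (RCLike.ofReal ∘ hH.eigenvalues) Finset.univ.val := by
    rw [hAL, Matrix.charpoly_mul_comm, hH.roots_charpoly_eq_eigenvalues]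
  have hA2 : A * A = c (-(Jmat d * M * (Jmat d * M))) := by
    rw [hA, Matrix.smul_mul, Matrix.mul_smul, smul_smul, Complex.I_mul_I, map_neg, ← map_mul]
    simp
  refine ⟨hH.eigenvalues, ?_, fun q => ?_, fun i => ?_⟩
  · rw [Ent, hcmap, ← hA, hroots, Multiset.map_map]
    rfl
  · apply Complex.ofReal_injective
    have h1 := trace_aeval_of_isHermitian hH ((q.map (algebraMap ℝ ℂ)).comp (Polynomial.X ^ 2))
    rw [← trace_aeval_mul_comm, ← hAL, Polynomial.aeval_comp, map_pow, Polynomial.aeval_X, sq, hA2,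
      Polynomial.aeval_map_algebraMap, Polynomial.aeval_algHom_apply] at h1
    have h2 : ∀ X : Matrix (Fin d) (Fin d) ℝ, (c X).trace = ((X.trace : ℝ) : ℂ) := by
      intro X
      simp [Matrix.trace, ← hcmap]
    rw [h2] at h1
    rw [h1, Complex.ofReal_sum]
    refine Finset.sum_congr rfl fun i _ => ?_
    have h3 : ((hH.eigenvalues i : ℂ)) ^ 2 = algebraMap ℝ ℂ (hH.eigenvalues i ^ 2) := by simp
    rw [Polynomial.eval_comp, Polynomial.eval_pow, Polynomial.eval_X, h3, Polynomial.eval_map,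
      Polynomial.eval₂_at_apply]
    rfl
  · have hroot : (hH.eigenvalues i : ℂ) ∈ A.charpoly.roots := by
      rw [hroots]
      exact Multiset.mem_map.mpr ⟨i, Finset.mem_univ_val i, rfl⟩
    have hev : Module.End.HasEigenvalue (Matrix.toLin' A) (hH.eigenvalues i : ℂ) := by
      rw [Module.End.hasEigenvalue_iff_isRoot_charpoly, Matrix.charpoly_toLin']
      exact (Polynomial.mem_roots'.mp hroot).2
    have hev2 := hev.pow 2
    rw [sq (Matrix.toLin' A), Module.End.mul_eq_comp, ← Matrix.toLin'_mul, hA2] at hev2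
    obtain ⟨k, hk⟩ := eigenvalue_mem_ball hev2
    refine ⟨k, ?_⟩
    have hn : ∀ X : Matrix (Fin d) (Fin d) ℝ, ∀ a b, c X a b = ((X a b : ℝ) : ℂ) :=
      fun X a b => rfl
    rw [mem_closedBall_iff_norm, hn] at hk
    simp only [hn, Complex.norm_real, Real.norm_eq_abs] at hk
    rwa [← Complex.ofReal_pow, ← Complex.ofReal_sub, Complex.norm_real, Real.norm_eq_abs] at hk

theorem eventually_posSemidef_diagonal_add_smul {d : ℕ} {δ : Fin d → ℝ} (hδ : ∀ i, 1 ≤ δ i)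
    {P : Matrix (Fin d) (Fin d) ℝ} (hP : P.transpose = P) :
    ∀ᶠ t in nhds (0 : ℝ), (Matrix.diagonal δ + t • P).PosSemidef := by
  set c := ∑ i, ∑ j, |P i j| with hc
  have hev : ∀ᶠ t in nhds (0 : ℝ), |t| * c < 1 := by
    have : Continuous fun t : ℝ => |t| * c := by fun_prop
    refine this.continuousAt.eventually_lt continuousAt_const ?_
    simp
  filter_upwards [hev] with t ht
  refine Matrix.PosSemidef.of_dotProduct_mulVec_nonneg ?_ fun x => ?_
  · rw [Matrix.IsHermitian, Matrix.conjTranspose_eq_transpose_of_trivial, Matrix.transpose_add,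
      Matrix.diagonal_transpose, Matrix.transpose_smul, hP]
  · have e : star x ⬝ᵥ (Matrix.diagonal δ + t • P).mulVec x =
        ∑ i, δ i * x i ^ 2 + t * ∑ i, ∑ j, x i * P i j * x j := by
      rw [Matrix.add_mulVec, Matrix.smul_mulVec, dotProduct_add, dotProduct_smul, smul_eq_mul]
      congr 1
      · simp only [dotProduct, Matrix.mulVec_diagonal]
        exact Finset.sum_congr rfl fun i _ => by simp; ring
      · congr 1
        simp only [dotProduct, Matrix.mulVec, Finset.mul_sum]
        exact Finset.sum_congr rfl fun i _ => Finset.sum_congr rfl fun j _ => by simp; ring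
    rw [e]
    set Q := ∑ i, x i ^ 2 with hQ
    have hQ0 : 0 ≤ Q := Finset.sum_nonneg fun i _ => sq_nonneg _
    have h1 : Q ≤ ∑ i, δ i * x i ^ 2 :=
      Finset.sum_le_sum fun i _ => le_mul_of_one_le_left (sq_nonneg _) (hδ i)
    have hxQ : ∀ i, x i ^ 2 ≤ Q := fun i =>
      Finset.single_le_sum (f := fun i => x i ^ 2) (fun i _ => sq_nonneg _) (Finset.mem_univ i)
    have h2 : |∑ i, ∑ j, x i * P i j * x j| ≤ c * Q := by
      rw [hc, Finset.sum_mul]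
      refine (Finset.abs_sum_le_sum_abs _ _).trans (Finset.sum_le_sum fun i _ => ?_)
      rw [Finset.sum_mul]
      refine (Finset.abs_sum_le_sum_abs _ _).trans (Finset.sum_le_sum fun j _ => ?_)
      have : |x i| * |x j| ≤ Q := by
        have := two_mul_le_add_sq |x i| |x j|
        rw [sq_abs, sq_abs] at this
        linarith [hxQ i, hxQ j]
      calc |x i * P i j * x j| = |P i j| * (|x i| * |x j|) := by rw [abs_mul, abs_mul]; ring
        _ ≤ |P i j| * Q := mul_le_mul_of_nonneg_left this (abs_nonneg _)
    have h3 : |t * ∑ i, ∑ j, x i * P i j * x j| ≤ Q := by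
      rw [abs_mul]
      calc |t| * |∑ i, ∑ j, x i * P i j * x j| ≤ |t| * (c * Q) :=
            mul_le_mul_of_nonneg_left h2 (abs_nonneg _)
        _ = |t| * c * Q := by ring
        _ ≤ Q := mul_le_of_le_one_left hQ0 ht.le
    linarith [neg_le_of_abs_le h3]

/-- A real function with vanishing value and derivative at all points `e i` is `o(t)` along
points at distance `O(t)` from the `e i`. -/
theorem eventually_abs_le_of_hasDerivAt_zero {ι : Type*} [Finite ι] {r : ℝ → ℝ} {e : ι → ℝ}
    (h0 : ∀ i, r (e i) = 0) (h : ∀ i, HasDerivAt r 0 (e i)) (C : ℝ) {ε : ℝ} (hε : 0 < ε) :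
    ∀ᶠ t in nhds (0 : ℝ), ∀ s i, |s - e i| ≤ C * |t| → |r s| ≤ ε * |t| := by
  set D := |C| + 1 with hD
  have hD0 : 0 < D := by positivity
  have h1 : ∀ᶠ u in nhds (0 : ℝ), ∀ i, |r (e i + u)| ≤ ε / D * |u| := by
    rw [Filter.eventually_all]
    intro i
    have h2 := (hasDerivAt_iff_isLittleO_nhds_zero.mp (h i)).def (c := ε / D) (by positivity)
    simpa [h0 i] using h2
  obtain ⟨η, hη, h3⟩ := Metric.eventually_nhds_iff.mp h1
  have h4 : ∀ᶠ t in nhds (0 : ℝ), D * |t| < η := by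
    have : Continuous fun t : ℝ => D * |t| := by fun_prop
    refine this.continuousAt.eventually_lt continuousAt_const ?_
    simpa using hη
  filter_upwards [h4] with t ht s i hs
  have h5 : |s - e i| ≤ D * |t| :=
    hs.trans (mul_le_mul_of_nonneg_right (by linarith [le_abs_self C]) (abs_nonneg t))
  have h6 := h3 (y := s - e i) (by simpa using h5.trans_lt ht) i
  rw [add_sub_cancel] at h6
  calc |r s| ≤ ε / D * |s - e i| := h6
    _ ≤ ε / D * (D * |t|) := by gcongr
    _ = ε * |t| := by field_simp

theorem hasDerivAt_Ent {d : ℕ} (hJ : Jmat d * Jmat d = -1) (lam : ℕ → ℝ)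
    (hlam : ∀ i : Fin d, 1 < lam ((i : ℕ) / 2)) {P : Matrix (Fin d) (Fin d) ℝ}
    (hP : P.transpose = P) :
    HasDerivAt (fun t : ℝ => Ent (Dmat d lam + t • P))
      (1 / 4 * ∑ i : Fin d, betaFn (lam ((i : ℕ) / 2)) * P i i) 0 := by
  set J := Jmat d with hJdef
  set δ : Fin d → ℝ := fun i => lam ((i : ℕ) / 2) with hδ
  have hD : Dmat d lam = Matrix.diagonal δ := rfl
  set D := Matrix.diagonal δ with hDdef
  have hJD : J * D = D * J := Jmat_mul_Dmat d lam
  set N : ℝ → Matrix (Fin d) (Fin d) ℝ := fun t => -(J * (D + t • P) * (J * (D + t • P))) with hN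
  set X := D * P - J * P * J * D with hX
  set Y := -(J * P * J * P) with hY
  have hJDJ : J * D * J = -D := by rw [hJD, mul_assoc, hJ]; simp
  have hNt : ∀ t, N t = D * D + t • X + t ^ 2 • Y := by
    intro t
    have e1 : J * D * (J * D) = -(D * D) := by rw [← mul_assoc, hJDJ, neg_mul]
    have e2 : J * D * (J * P) = -(D * P) := by rw [← mul_assoc, hJDJ, neg_mul]
    simp only [hN, hX, hY, mul_add, add_mul, Matrix.mul_smul, Matrix.smul_mul, e1, e2]
    simp only [← mul_assoc, smul_smul, smul_sub, smul_neg, ← sq t]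
    abel
  have hN0 : N 0 = Matrix.diagonal fun i => δ i ^ 2 := by
    simp [hNt, hDdef, Matrix.diagonal_mul_diagonal, sq]
  have hNd : ∀ i j, HasDerivAt (fun t => N t i j) (X i j) 0 := by
    intro i j
    have h1 : HasDerivAt (fun t : ℝ => (D * D) i j + t * X i j + t ^ 2 * Y i j)
        (1 * X i j + (2 : ℕ) * (0 : ℝ) ^ (2 - 1) * Y i j) 0 :=
      (((hasDerivAt_id (0 : ℝ)).mul_const (X i j)).const_add ((D * D) i j)).add
        ((hasDerivAt_pow 2 (0 : ℝ)).mul_const (Y i j))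
    have h2 : (fun t => N t i j) = fun t : ℝ => (D * D) i j + t * X i j + t ^ 2 * Y i j := by
      ext t
      simp [hNt]
    rw [h2]
    simpa using h1
  obtain ⟨q, hq⟩ := exists_polynomial_eval_derivative_eval
    (Finset.univ.image fun i => δ i ^ 2) (fun s => GFn (√s)) (fun s => betaFn (√s) / (4 * √s))
  have hsqrt : ∀ i, √(δ i ^ 2) = δ i := fun i => Real.sqrt_sq (by linarith [hlam i])
  have hq0 : ∀ i, q.eval (δ i ^ 2) = GFn (√(δ i ^ 2)) := fun i =>
    (hq _ (Finset.mem_image_of_mem _ (Finset.mem_univ i))).1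
  have hq1 : ∀ i, q.derivative.eval (δ i ^ 2) = betaFn (δ i) / (4 * δ i) := fun i => by
    rw [(hq _ (Finset.mem_image_of_mem _ (Finset.mem_univ i))).2, hsqrt]
  -- The trace of the interpolating polynomial has the claimed derivative.
  have htrace : HasDerivAt (fun t => (Polynomial.aeval (N t) q).trace / 2)
      (1 / 4 * ∑ i : Fin d, betaFn (δ i) * P i i) 0 := by
    obtain ⟨Z, hZ, hZd⟩ := exists_hasDerivAt_aeval N X _ hNd hN0 q
    have h1 : HasDerivAt (fun t => (Polynomial.aeval (N t) q).trace / 2) ((∑ i, Z i i) / 2) 0 :=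
      (HasDerivAt.fun_sum fun i _ => hZ i i).div_const 2
    refine h1.congr_deriv ?_
    set E : Matrix (Fin d) (Fin d) ℝ := Matrix.diagonal fun i => betaFn (δ i) with hE
    have hJE : J * E = E * J := Jmat_mul_Dmat d (fun k => betaFn (lam k))
    have h2 : ∀ i, Z i i = (betaFn (δ i) * P i i - betaFn (δ i) * (J * P * J) i i) / 4 := by
      intro i
      have h3 : δ i ≠ 0 := by linarith [hlam i]
      rw [hZd, hq1, hX, Matrix.sub_apply, hDdef, Matrix.diagonal_mul, Matrix.mul_diagonal]
      field_simp
    have h4 : ∑ i, betaFn (δ i) * (J * P * J) i i = -∑ i, betaFn (δ i) * P i i := by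
      have h5 : ∀ A : Matrix (Fin d) (Fin d) ℝ, ∑ i, betaFn (δ i) * A i i = (E * A).trace := by
        intro A
        simp [Matrix.trace, hE, Matrix.diagonal_mul]
      rw [h5, h5, ← mul_assoc, Matrix.trace_mul_comm, ← mul_assoc, ← mul_assoc, hJE, mul_assoc E,
        hJ]
      simp
    simp only [h2]
    rw [← Finset.sum_div, Finset.sum_sub_distrib, h4]
    ring
  -- The remainder is `o(t)`.
  set r : ℝ → ℝ := fun s => GFn (√s) - q.eval s with hr
  have hr0 : ∀ i, r (δ i ^ 2) = 0 := fun i => by simp only [hr, hq0, sub_self]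
  have hr1 : ∀ i, HasDerivAt r 0 (δ i ^ 2) := fun i => by
    refine ((hasDerivAt_GFn_sqrt (hlam i)).sub (q.hasDerivAt _)).congr_deriv ?_
    rw [hq1, sub_self]
  set C := ∑ i, ∑ j, (|X i j| + |Y i j|) with hC
  have hbound : ∀ ε : ℝ, 0 < ε → ∀ᶠ t in nhds (0 : ℝ),
      |Ent (D + t • P) - (Polynomial.aeval (N t) q).trace / 2| ≤ ε * |t| := by
    intro ε hε
    have hε' : 0 < ε / (d + 1) := by positivity
    have ht1 : ∀ᶠ t in nhds (0 : ℝ), |t| < 1 :=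
      continuous_abs.continuousAt.eventually_lt continuousAt_const (by simp)
    filter_upwards [eventually_posSemidef_diagonal_add_smul (fun i => (hlam i).le) hP, ht1,
      eventually_abs_le_of_hasDerivAt_zero hr0 hr1 C hε'] with t hpsd ht htr
    obtain ⟨ev, hev1, hev2, hev3⟩ := exists_eigenvalues_Ent hpsd
    rw [hev1, ← hev2 q, ← sub_div, ← Finset.sum_sub_distrib]
    have hle : ∀ i, |GFn |ev i| - q.eval (ev i ^ 2)| ≤ ε / (d + 1) * |t| := by
      intro i
      obtain ⟨k, hk⟩ := hev3 i
      have hent : ∀ j, |N t k j - N 0 k j| ≤ (|X k j| + |Y k j|) * |t| := by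
        intro j
        have e : N t k j - N 0 k j = t * X k j + t ^ 2 * Y k j := by
          simp [hNt]
          ring
        have h2 : |t| * |t| ≤ |t| := mul_le_of_le_one_left (abs_nonneg t) ht.le
        rw [e]
        refine (abs_add_le _ _).trans ?_
        rw [abs_mul, abs_mul, abs_pow, sq]
        nlinarith [mul_le_mul_of_nonneg_right h2 (abs_nonneg (Y k j))]
      have hk' : |ev i ^ 2 - δ k ^ 2| ≤ C * |t| := by
        have hoff : ∀ j ∈ Finset.univ.erase k, |N t k j| = |N t k j - N 0 k j| := by
          intro j hj
          rw [hN0, Matrix.diagonal_apply_ne _ (Finset.ne_of_mem_erase hj).symm, sub_zero]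
        have hdiag : δ k ^ 2 = N 0 k k := by rw [hN0, Matrix.diagonal_apply_eq]
        calc |ev i ^ 2 - δ k ^ 2| = |(ev i ^ 2 - N t k k) + (N t k k - N 0 k k)| := by
              rw [hdiag]; ring_nf
          _ ≤ |ev i ^ 2 - N t k k| + |N t k k - N 0 k k| := abs_add_le _ _
          _ ≤ ∑ j ∈ Finset.univ.erase k, |N t k j| + |N t k k - N 0 k k| := by gcongr
          _ = ∑ j, |N t k j - N 0 k j| := by
              rw [Finset.sum_congr rfl hoff, Finset.sum_erase_add _ _ (Finset.mem_univ k)]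
          _ ≤ ∑ j, (|X k j| + |Y k j|) * |t| := Finset.sum_le_sum fun j _ => hent j
          _ = (∑ j, (|X k j| + |Y k j|)) * |t| := by rw [Finset.sum_mul]
          _ ≤ C * |t| := by
              refine mul_le_mul_of_nonneg_right ?_ (abs_nonneg t)
              exact Finset.single_le_sum (f := fun k => ∑ j, (|X k j| + |Y k j|))
                (fun k _ => Finset.sum_nonneg fun j _ => by positivity) (Finset.mem_univ k)
      have := htr (ev i ^ 2) k hk'
      simp only [hr] at this
      rwa [Real.sqrt_sq_eq_abs] at this
    calc |(∑ i, (GFn |ev i| - q.eval (ev i ^ 2))) / 2|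
        ≤ |∑ i, (GFn |ev i| - q.eval (ev i ^ 2))| := by
          rw [abs_div, abs_two]
          linarith [abs_nonneg (∑ i, (GFn |ev i| - q.eval (ev i ^ 2)))]
      _ ≤ ∑ i : Fin d, ε / (d + 1) * |t| :=
          (Finset.abs_sum_le_sum_abs _ _).trans (Finset.sum_le_sum fun i _ => hle i)
      _ = d / (d + 1) * (ε * |t|) := by
          rw [Finset.sum_const, Finset.card_univ, Fintype.card_fin, nsmul_eq_mul]
          ring
      _ ≤ ε * |t| := by
          refine mul_le_of_le_one_left (by positivity) ?_
          rw [div_le_one (by positivity)]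
          linarith
  have hrem : HasDerivAt (fun t => Ent (D + t • P) - (Polynomial.aeval (N t) q).trace / 2) 0 0 := by
    have h0 : Ent (D + (0 : ℝ) • P) - (Polynomial.aeval (N 0) q).trace / 2 = 0 := by
      have := (hbound 1 one_pos).self_of_nhds
      simpa only [abs_zero, mul_zero, abs_nonpos_iff] using this
    rw [hasDerivAt_iff_isLittleO_nhds_zero, Asymptotics.isLittleO_iff]
    intro ε hε
    filter_upwards [hbound ε hε] with t ht
    simpa only [zero_add, h0, sub_zero, smul_zero, Real.norm_eq_abs] using ht
  rw [hD]
  refine ((hrem.fun_add htrace).congr_deriv (zero_add _)).congr_of_eventuallyEq ?_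
  exact Filter.Eventually.of_forall fun t => (sub_add_cancel _ _).symm

theorem sum_fin_eq_sum_pairs (f : ℕ → ℝ) {d : ℕ} (N : ℕ) (hd : d = 2 * N) :
    ∑ i : Fin d, f i = ∑ j : Fin N, (f (2 * j) + f (2 * j + 1)) := by
  subst hd
  rw [Fin.sum_univ_eq_sum_range, Fin.sum_univ_eq_sum_range (fun j => f (2 * j) + f (2 * j + 1))]
  induction N with
  | zero => simp
  | succ n ih => rw [Finset.sum_range_succ, ← ih, mul_add, Finset.sum_range_succ,
      Finset.sum_range_succ, add_assoc]

/-- De Bruijn identity for Gaussian states and conditional entropy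
(Theorem 5.4, explicit Gaussian form). -/
theorem de_bruijn_conditional (m n : ℕ) (hm : 1 ≤ m) (hn : 1 ≤ n)
    (A : Matrix (Fin (2 * m)) (Fin (2 * m)) ℝ) (K : Matrix (Fin (2 * m)) (Fin (2 * n)) ℝ)
    (B : Matrix (Fin (2 * n)) (Fin (2 * n)) ℝ)
    (hsymm : (assemble2 A K B).IsSymm) (hpd : (assemble2 A K B).PosDef)
    (S : Matrix (Fin (2 * m + 2 * n)) (Fin (2 * m + 2 * n)) ℝ) (hS : IsSymplectic S)
    (lam : ℕ → ℝ) (hdiag : S * assemble2 A K B * S.transpose = Dmat (2 * m + 2 * n) lam)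
    (hlam : ∀ ℓ < m + n, 1 < lam ℓ) :
    HasDerivAt
      (fun t : ℝ => Ent (assemble2 A K B + t • IA0B (2 * m + 2 * n) (2 * m)) - Ent B)
      (1 / 4 * ∑ j : Fin (m + n), betaFn (lam j) *
        ∑ k : Fin (2 * m),
          (S ⟨2 * j, by have := j.isLt; omega⟩ ⟨k, by have := k.isLt; omega⟩ ^ 2 +
           S ⟨2 * j + 1, by have := j.isLt; omega⟩ ⟨k, by have := k.isLt; omega⟩ ^ 2))
      0 := by
  have hJ := Jmat_mul_self (m + n) (2 * m + 2 * n) (by ring)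
  set P := S * IA0B (2 * m + 2 * n) (2 * m) * S.transpose with hP
  have hPT : P.transpose = P := by
    rw [hP, IA0B, Matrix.transpose_mul, Matrix.transpose_mul, Matrix.transpose_transpose,
      Matrix.diagonal_transpose, Matrix.mul_assoc]
  have hmain := (hasDerivAt_Ent hJ lam (fun i => hlam _ (by have := i.isLt; omega)) hPT).sub_const
    (Ent B)
  have hfun : (fun t : ℝ => Ent (assemble2 A K B + t • IA0B (2 * m + 2 * n) (2 * m)) - Ent B) =
      fun t : ℝ => Ent (Dmat (2 * m + 2 * n) lam + t • P) - Ent B := by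
    ext t
    rw [← Ent_symplectic hJ hS, Matrix.mul_add, Matrix.add_mul, hdiag, Matrix.mul_smul,
      Matrix.smul_mul]
  rw [hfun]
  refine hmain.congr_deriv ?_
  congr 1
  have hPd : ∀ i, P i i = ∑ k : Fin (2 * m), S i ⟨k, by have := k.isLt; omega⟩ ^ 2 := by
    intro i
    have h1 : P i i = ∑ k : Fin (2 * m + 2 * n), if (k : ℕ) < 2 * m then S i k ^ 2 else 0 := by
      rw [hP, IA0B, Matrix.mul_apply]
      refine Finset.sum_congr rfl fun k _ => ?_
      rw [Matrix.mul_diagonal, Matrix.transpose_apply]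
      split_ifs <;> ring
    rw [h1, Fin.sum_univ_add]
    simp [Fin.castAdd, Fin.castLE]
  have hpairs := sum_fin_eq_sum_pairs
    (fun i => if h : i < 2 * m + 2 * n then betaFn (lam (i / 2)) * P ⟨i, h⟩ ⟨i, h⟩ else 0)
    (d := 2 * m + 2 * n) (m + n) (by ring)
  simp only [Fin.is_lt, dite_true, Fin.eta] at hpairs
  rw [hpairs]
  refine Finset.sum_congr rfl fun j _ => ?_
  have hj := j.isLt
  rw [dif_pos (by omega), dif_pos (by omega), hPd, hPd, Finset.sum_add_distrib, mul_add,
    Nat.mul_div_cancel_left _ two_pos, show (2 * (j : ℕ) + 1) / 2 = j by omega]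

end
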